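/- arXiv:1210.3433 — 3 statements merged into one kernel-verified Lean document; each statement's English description precedes it below -/
import Mathlib

section
/- Let f(x,y) ∈ ℤ[x,y] be a squarefree, non-constant polynomial in two variables. Then there exists a constant C > 0 (depending only on f) such that for every prime p, the number of matrices g ∈ GL₂(ℤ/p²ℤ) with f(tr g, det g) ≡ 0 (mod p²) is at most C·p⁶. -/
open Matrix MvPolynomial

/-- **Gauss's lemma** for squarefreeness. -/
theorem Squarefree.map_fraction_map {A : Type*} [CommRing A] [IsDomain A]
    [UniqueFactorizationMonoid A] (K : Type*) [Field K] [Algebra A K] [IsFractionRing A K]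
    {f : Polynomial A} (hf : Squarefree f) : Squarefree (f.map (algebraMap A K)) := by
  obtain ⟨_⟩ : Nonempty (NormalizedGCDMonoid A) := inferInstance
  intro x hx
  have hinj : Function.Injective (algebraMap A K) := IsFractionRing.injective A K
  have hx0 : x ≠ 0 := by
    rintro rfl
    rw [zero_mul, zero_dvd_iff, Polynomial.map_eq_zero_iff hinj] at hx
    exact hf.ne_zero hx
  set N := IsLocalization.integerNormalization (nonZeroDivisors A) x
  obtain ⟨c, hc0, hc⟩ := IsLocalization.integerNormalization_spec (nonZeroDivisors A) x
  refine Polynomial.isUnit_or_eq_zero_of_isUnit_integerNormalization_primPart hx0 (hf _ ?_)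
  refine (N.isPrimitive_primPart.mul N.isPrimitive_primPart).dvd_of_fraction_map_dvd_fraction_map
    (K := K) ?_
  rw [Polynomial.map_mul]
  have hdvd : N.primPart.map (algebraMap A K) ∣ x := by
    have h1 : N.primPart.map (algebraMap A K) ∣ N.map (algebraMap A K) :=
      Polynomial.map_dvd _ N.primPart_dvd
    rw [hc, ← IsScalarTower.algebraMap_smul K c x, Polynomial.smul_eq_C_mul] at h1
    refine (IsUnit.dvd_mul_left (Polynomial.isUnit_C.2 (IsUnit.mk0 _ ?_))).1 h1
    exact (map_ne_zero_iff _ hinj).2 (nonZeroDivisors.ne_zero hc0)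
  exact (mul_dvd_mul hdvd hdvd).trans hx

theorem exists_C_mem_span_derivative {A : Type*} [CommRing A] [IsDomain A]
    [UniqueFactorizationMonoid A] [CharZero A] {f : Polynomial A} (hf : Squarefree f) :
    ∃ a : A, a ≠ 0 ∧ Polynomial.C a ∈ Ideal.span {f, Polynomial.derivative f} := by
  let K := FractionRing A
  have hsep : (f.map (algebraMap A K)).Separable :=
    PerfectField.separable_iff_squarefree.2 (hf.map_fraction_map K)
  let := Polynomial.algebra A K
  have := Polynomial.isLocalization (nonZeroDivisors A) K
  have h1 : (1 : Polynomial K) ∈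
      (Ideal.span {f, Polynomial.derivative f}).map (algebraMap (Polynomial A) (Polynomial K)) := by
    obtain ⟨u, v, huv⟩ := hsep
    rw [Ideal.map_span, Set.image_pair, Ideal.mem_span_pair]
    exact ⟨u, v, by simpa [Polynomial.derivative_map] using huv⟩
  rw [IsLocalization.mem_map_algebraMap_iff ((nonZeroDivisors A).map Polynomial.C)] at h1
  obtain ⟨⟨⟨g, hg⟩, ⟨m, hm⟩⟩, h⟩ := h1
  obtain ⟨a, ha, rfl⟩ := hm
  refine ⟨a, nonZeroDivisors.ne_zero ha, ?_⟩
  have hga : Polynomial.C a = g :=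
    Polynomial.map_injective _ (IsFractionRing.injective A K) (by simpa using h)
  rwa [hga]

theorem finSuccEquiv_pderiv_zero {R : Type*} [CommRing R] {n : ℕ}
    (f : MvPolynomial (Fin (n + 1)) R) :
    finSuccEquiv R n (pderiv 0 f) = Polynomial.derivative (finSuccEquiv R n f) := by
  induction f using MvPolynomial.induction_on with
  | C a => simp [finSuccEquiv_apply]
  | add p q hp hq => simp [hp, hq]
  | mul_X p i hp =>
    cases i using Fin.cases <;>
      simp [hp, finSuccEquiv_X_zero, finSuccEquiv_X_succ, mul_comm]

theorem finSuccEquiv_rename_succ {R : Type*} [CommRing R] {n : ℕ} (a : MvPolynomial (Fin n) R) :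
    finSuccEquiv R n (rename Fin.succ a) = Polynomial.C a := by
  induction a using MvPolynomial.induction_on with
  | C a => simp [finSuccEquiv_apply]
  | add p q hp hq => simp [hp, hq]
  | mul_X p i hp => simp [hp, finSuccEquiv_X_succ]

/-- Eliminating the first variable from `f = ∂f/∂x = 0`. -/
theorem exists_eliminant_pderiv_zero {f : MvPolynomial (Fin 2) ℤ} (hf : Squarefree f) :
    ∃ a : MvPolynomial (Fin 1) ℤ, a ≠ 0 ∧ ∀ (R : Type) [CommRing R] (v : Fin 2 → R),
      aeval v f = 0 → aeval v (pderiv 0 f) = 0 → aeval (fun _ => v 1) a = 0 := by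
  have hf' : Squarefree (finSuccEquiv ℤ 1 f) := by
    intro x hx
    have := hf ((finSuccEquiv ℤ 1).symm x) (by
      rw [← map_mul]
      simpa using map_dvd (finSuccEquiv ℤ 1).symm hx)
    simpa using this
  obtain ⟨a, ha, hmem⟩ := exists_C_mem_span_derivative hf'
  refine ⟨a, ha, fun R _ v h0 h1 => ?_⟩
  rw [← finSuccEquiv_pderiv_zero, Ideal.mem_span_pair] at hmem
  obtain ⟨u, w, huw⟩ := hmem
  have key : rename Fin.succ a = (finSuccEquiv ℤ 1).symm u * f
      + (finSuccEquiv ℤ 1).symm w * pderiv 0 f := by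
    apply (finSuccEquiv ℤ 1).injective
    simp [huw, finSuccEquiv_rename_succ]
  have h2 := congrArg (aeval v) key
  rw [map_add, map_mul, map_mul, h0, h1, aeval_rename] at h2
  have hv : v ∘ Fin.succ = fun _ : Fin 1 => v 1 := by
    ext i; fin_cases i; rfl
  simpa [hv] using h2

/-- Eliminating the second variable from `f = ∂f/∂y = 0`. -/
theorem exists_eliminant_pderiv_one {f : MvPolynomial (Fin 2) ℤ} (hf : Squarefree f) :
    ∃ a : MvPolynomial (Fin 1) ℤ, a ≠ 0 ∧ ∀ (R : Type) [CommRing R] (v : Fin 2 → R),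
      aeval v f = 0 → aeval v (pderiv 1 f) = 0 → aeval (fun _ => v 0) a = 0 := by
  let s : Equiv.Perm (Fin 2) := Equiv.swap 0 1
  have hf' : Squarefree (rename s f) := by
    intro x hx
    have := hf ((renameEquiv ℤ s).symm x) (by
      rw [← map_mul]
      have := map_dvd (renameEquiv ℤ s).symm hx
      rwa [show (renameEquiv ℤ s).symm (rename s f) = f from
        (renameEquiv ℤ s).symm_apply_apply f] at this)
    exact (MulEquiv.isUnit_map (renameEquiv ℤ s).symm).1 this
  obtain ⟨a, ha, h⟩ := exists_eliminant_pderiv_zero hf'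
  refine ⟨a, ha, fun R _ v h0 h1 => ?_⟩
  have hv : (v ∘ s) ∘ s = v := by
    ext i; simp [s]
  have := h R (v ∘ s) (by rwa [aeval_rename, hv]) (by
    rw [show (0 : Fin 2) = s 1 by simp [s], pderiv_rename s.injective, aeval_rename, hv]
    exact h1)
  simpa [s] using this

/-- A nonzero integer polynomial has nonzero reduction modulo all large enough integers. -/
theorem exists_forall_map_zmod_ne_zero {σ : Type*} {f : MvPolynomial σ ℤ} (hf : f ≠ 0) :
    ∃ B : ℕ, ∀ p : ℕ, B < p → map (Int.castRingHom (ZMod p)) f ≠ 0 := by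
  obtain ⟨m, hm⟩ := ne_zero_iff.1 hf
  refine ⟨(coeff m f).natAbs, fun p hp h => hm ?_⟩
  have h1 := congrArg (coeff m) h
  rw [coeff_map, coeff_zero, eq_intCast, ZMod.intCast_zmod_eq_zero_iff_dvd] at h1
  exact Int.eq_zero_of_dvd_of_natAbs_lt_natAbs h1 (by simpa using hp)

/-- First-order Taylor expansion in the direction of a coordinate. -/
theorem aeval_add_single_of_sq_eq_zero {σ R S : Type*} [DecidableEq σ] [CommRing R] [CommRing S]
    [Algebra R S] (f : MvPolynomial σ R) (v : σ → S) (i : σ) {e : S} (he : e ^ 2 = 0) :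
    aeval (v + Pi.single i e) f = aeval v f + e * aeval v (pderiv i f) := by
  induction f using MvPolynomial.induction_on with
  | C a => simp
  | add p q hp hq => simp only [map_add, hp, hq]; ring
  | mul_X p j hp =>
    obtain rfl | hij := eq_or_ne j i
    · simp [hp]
      linear_combination aeval v (pderiv j p) * he
    · simp [hp, pderiv_X_of_ne hij, hij]
      ring

/-- **Schwartz–Zippel** over a whole finite field, in cleared form. -/
theorem card_zeros_le {p : ℕ} [Fact p.Prime] {n : ℕ} {f : MvPolynomial (Fin (n + 1)) ℤ}
    (hf : map (Int.castRingHom (ZMod p)) f ≠ 0) :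
    Fintype.card {v : Fin (n + 1) → ZMod p // aeval v f = 0} ≤ f.totalDegree * p ^ n := by
  have hdeg : (map (Int.castRingHom (ZMod p)) f).totalDegree ≤ f.totalDegree :=
    Finset.sup_mono (support_map_subset _ _)
  have h := schwartz_zippel_totalDegree hf Finset.univ
  have hp : (0 : ℚ≥0) < p := by exact_mod_cast (Fact.out : p.Prime).pos
  have hcard : Fintype.card {v : Fin (n + 1) → ZMod p // aeval v f = 0} =
      (Finset.filter (fun v => eval v (map (Int.castRingHom (ZMod p)) f) = 0)
        (Fintype.piFinset fun _ : Fin (n + 1) => Finset.univ)).card := by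
    rw [Fintype.card_subtype, Fintype.piFinset_univ]
    congr 1
    ext v
    rw [Finset.mem_filter, Finset.mem_filter, eval_map, aeval_def, algebraMap_int_eq]
  rw [← hcard, Finset.card_univ, ZMod.card, div_le_div_iff₀ (pow_pos hp _) hp,
    pow_succ, ← mul_assoc, mul_le_mul_iff_left₀ hp] at h
  exact le_trans (by exact_mod_cast h) (Nat.mul_le_mul_right _ hdeg)

section ZModSq

variable {p : ℕ} [Fact p.Prime]

variable (p) in
/-- Reduction `ℤ/p²ℤ → ℤ/pℤ`. -/
def redSq : ZMod (p ^ 2) →+* ZMod p := ZMod.castHom (dvd_pow_self p two_ne_zero) (ZMod p)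

theorem redSq_natCast_val (x : ZMod (p ^ 2)) : ((x.val : ℕ) : ZMod p) = redSq p x := by
  conv_rhs => rw [← ZMod.natCast_zmod_val x, map_natCast]

theorem isUnit_of_redSq_ne_zero {x : ZMod (p ^ 2)} (hx : redSq p x ≠ 0) : IsUnit x := by
  rw [← redSq_natCast_val, Ne, ZMod.natCast_eq_zero_iff] at hx
  rw [← ZMod.natCast_zmod_val x, ZMod.isUnit_iff_coprime]
  exact (((Nat.Prime.coprime_iff_not_dvd Fact.out).2 hx).symm).pow_right 2

theorem sq_eq_zero_of_redSq_eq_zero {x : ZMod (p ^ 2)} (hx : redSq p x = 0) : x ^ 2 = 0 := by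
  rw [← redSq_natCast_val, ZMod.natCast_eq_zero_iff] at hx
  rw [← ZMod.natCast_zmod_val x, ← Nat.cast_pow, ZMod.natCast_eq_zero_iff]
  exact pow_dvd_pow_of_dvd hx 2

theorem card_redSq_fiber_le (y : ZMod p) : Fintype.card {x : ZMod (p ^ 2) // redSq p x = y} ≤ p := by
  have hlt : ∀ x : ZMod (p ^ 2), x.val / p < p := fun x =>
    Nat.div_lt_of_lt_mul (by simpa [sq] using ZMod.val_lt x)
  let F : {x : ZMod (p ^ 2) // redSq p x = y} → Fin p := fun x => ⟨x.1.val / p, hlt x.1⟩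
  have hF : Function.Injective F := by
    rintro ⟨x, hx⟩ ⟨x', hx'⟩ h
    have hdiv : x.val / p = x'.val / p := by simpa [F] using h
    rw [← hx', ← redSq_natCast_val, ← redSq_natCast_val, ZMod.natCast_eq_natCast_iff'] at hx
    apply Subtype.ext
    apply ZMod.val_injective
    rw [← Nat.div_add_mod x.val p, ← Nat.div_add_mod x'.val p, hdiv, hx]
  simpa using Fintype.card_le_of_injective F hF

/-- Each element of `ℤ/p²ℤ` has at most `3p²` factorizations into two factors. -/
theorem card_mul_eq_le (m : ZMod (p ^ 2)) :
    Fintype.card {x : ZMod (p ^ 2) × ZMod (p ^ 2) // x.1 * x.2 = m} ≤ 3 * p ^ 2 := by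
  classical
  let Z := {x : ZMod (p ^ 2) // redSq p x = 0}
  let F : {x : ZMod (p ^ 2) × ZMod (p ^ 2) // x.1 * x.2 = m} →
      ZMod (p ^ 2) ⊕ ZMod (p ^ 2) ⊕ Z × Z := fun x =>
    if h1 : redSq p x.1.1 = 0 then
      if h2 : redSq p x.1.2 = 0 then .inr (.inr (⟨_, h1⟩, ⟨_, h2⟩)) else .inr (.inl x.1.2)
    else .inl x.1.1
  have hF : Function.Injective F := by
    rintro ⟨⟨b, c⟩, h⟩ ⟨⟨b', c'⟩, h'⟩ hFF
    simp only at h h'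
    by_cases h1 : redSq p b = 0 <;> by_cases h2 : redSq p c = 0 <;>
      by_cases h1' : redSq p b' = 0 <;> by_cases h2' : redSq p c' = 0 <;>
      simp [F, h1, h2, h1', h2'] at hFF
    · exact Subtype.ext (Prod.ext (congrArg Subtype.val hFF.1) (congrArg Subtype.val hFF.2))
    · subst hFF
      simpa using (isUnit_of_redSq_ne_zero h2).mul_left_injective (h.trans h'.symm)
    all_goals
      subst hFF
      simpa using (isUnit_of_redSq_ne_zero h1).mul_right_injective (h.trans h'.symm)
  have h := Fintype.card_le_of_injective F hF
  have hZ : Fintype.card Z ≤ p := card_redSq_fiber_le 0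
  simp only [Fintype.card_sum, Fintype.card_prod, ZMod.card] at h
  nlinarith

/-- At most `3p⁴` matrices over `ℤ/p²ℤ` have a given trace and determinant. -/
theorem card_trace_det_le (t d : ZMod (p ^ 2)) :
    Fintype.card {M : Matrix (Fin 2) (Fin 2) (ZMod (p ^ 2)) // M.trace = t ∧ M.det = d}
      ≤ 3 * p ^ 4 := by
  let F : {M : Matrix (Fin 2) (Fin 2) (ZMod (p ^ 2)) // M.trace = t ∧ M.det = d} →
      Σ a : ZMod (p ^ 2), {x : ZMod (p ^ 2) × ZMod (p ^ 2) // x.1 * x.2 = a * (t - a) - d} :=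
    fun M => ⟨M.1 0 0, (M.1 0 1, M.1 1 0), by
      obtain ⟨M, rfl, rfl⟩ := M
      simp only [Matrix.trace_fin_two, Matrix.det_fin_two]
      ring⟩
  have hF : Function.Injective F := by
    rintro ⟨M, ht, hd⟩ ⟨M', ht', hd'⟩ h
    have h00 : M 0 0 = M' 0 0 := congrArg (fun x => x.1) h
    have h01 : M 0 1 = M' 0 1 := congrArg (fun x => x.2.1.1) h
    have h10 : M 1 0 = M' 1 0 := congrArg (fun x => x.2.1.2) h
    rw [Matrix.trace_fin_two] at ht ht'
    have h11 : M 1 1 = M' 1 1 := by linear_combination ht - ht' - h00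
    apply Subtype.ext
    ext i j
    fin_cases i <;> fin_cases j <;> assumption
  refine (Fintype.card_le_of_injective F hF).trans ?_
  rw [Fintype.card_sigma]
  refine (Finset.sum_le_sum fun a _ => card_mul_eq_le _).trans ?_
  simp
  exact le_of_eq (by ring)

theorem redSq_aeval (f : MvPolynomial (Fin 2) ℤ) (v : Fin 2 → ZMod (p ^ 2)) :
    redSq p (aeval v f) = aeval (redSq p ∘ v) f := by
  rw [map_aeval, RingHom.ext_int ((redSq p).comp _) (algebraMap ℤ (ZMod p))]
  rfl

/-- A zero modulo `p` has at most `p²` lifts to a zero modulo `p²`. -/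
theorem card_lifts_le_sq (f : MvPolynomial (Fin 2) ℤ) (w : Fin 2 → ZMod p) :
    Fintype.card {v : Fin 2 → ZMod (p ^ 2) // aeval v f = 0 ∧ redSq p ∘ v = w} ≤ p ^ 2 := by
  let F : {v : Fin 2 → ZMod (p ^ 2) // aeval v f = 0 ∧ redSq p ∘ v = w} →
      {x // redSq p x = w 0} × {x // redSq p x = w 1} := fun v =>
    (⟨v.1 0, congrFun v.2.2 0⟩, ⟨v.1 1, congrFun v.2.2 1⟩)
  have hF : Function.Injective F := by
    rintro ⟨v, hv⟩ ⟨v', hv'⟩ h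
    have h0 : v 0 = v' 0 := congrArg (fun x => x.1.1) h
    have h1 : v 1 = v' 1 := congrArg (fun x => x.2.1) h
    apply Subtype.ext
    ext i
    fin_cases i <;> assumption
  have h := Fintype.card_le_of_injective F hF
  rw [Fintype.card_prod] at h
  calc _ ≤ _ := h
    _ ≤ p * p := Nat.mul_le_mul (card_redSq_fiber_le _) (card_redSq_fiber_le _)
    _ = p ^ 2 := (sq p).symm

/-- **Hensel**: a zero modulo `p` at which some partial derivative does not vanish has at most `p`
lifts to a zero modulo `p²`. -/
theorem card_lifts_le_of_pderiv_ne_zero (f : MvPolynomial (Fin 2) ℤ) (w : Fin 2 → ZMod p)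
    (i : Fin 2) (hi : aeval w (pderiv i f) ≠ 0) :
    Fintype.card {v : Fin 2 → ZMod (p ^ 2) // aeval v f = 0 ∧ redSq p ∘ v = w} ≤ p := by
  let F : {v : Fin 2 → ZMod (p ^ 2) // aeval v f = 0 ∧ redSq p ∘ v = w} →
      {x // redSq p x = w (1 - i)} := fun v => ⟨v.1 (1 - i), congrFun v.2.2 (1 - i)⟩
  have hF : Function.Injective F := by
    rintro ⟨v, hv, hvw⟩ ⟨v', hv', hvw'⟩ h
    have hne : v (1 - i) = v' (1 - i) := congrArg (fun x => x.1) h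
    set e := v' i - v i with he
    have hadd : v' = v + Pi.single i e := by
      ext j
      fin_cases i <;> fin_cases j <;> simp_all
    have hred : redSq p e = 0 := by
      have h1 := congrFun hvw i
      have h2 := congrFun hvw' i
      simp only [Function.comp_apply] at h1 h2
      rw [he, map_sub, h1, h2, sub_self]
    have hT := aeval_add_single_of_sq_eq_zero f v i (sq_eq_zero_of_redSq_eq_zero hred)
    rw [← hadd, hv, hv', zero_add] at hT
    have hu : IsUnit (aeval v (pderiv i f)) := by
      apply isUnit_of_redSq_ne_zero
      rwa [redSq_aeval, hvw]
    have he0 : e = 0 := (hu.mul_left_eq_zero).1 hT.symm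
    apply Subtype.ext
    simp [hadd, he0]
  exact (Fintype.card_le_of_injective F hF).trans (card_redSq_fiber_le _)

end ZModSq

section Counting

variable {p : ℕ} [Fact p.Prime]

theorem card_zeros_sq_le (f : MvPolynomial (Fin 2) ℤ) :
    Fintype.card {v : Fin 2 → ZMod (p ^ 2) // aeval v f = 0} ≤
      p * Fintype.card {w : Fin 2 → ZMod p // aeval w f = 0} +
      p ^ 2 * Fintype.card {w : Fin 2 → ZMod p //
        aeval w f = 0 ∧ aeval w (pderiv 0 f) = 0 ∧ aeval w (pderiv 1 f) = 0} := by
  classical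
  let F : {v : Fin 2 → ZMod (p ^ 2) // aeval v f = 0} →
      Σ w : {w : Fin 2 → ZMod p // aeval w f = 0},
        {v : Fin 2 → ZMod (p ^ 2) // aeval v f = 0 ∧ redSq p ∘ v = w.1} := fun v =>
    ⟨⟨redSq p ∘ v.1, by rw [← redSq_aeval, v.2, map_zero]⟩, ⟨v.1, v.2, rfl⟩⟩
  have hF : Function.Injective F := fun v v' h => Subtype.ext (congrArg (fun x => x.2.1) h)
  refine (Fintype.card_le_of_injective F hF).trans ?_
  rw [Fintype.card_sigma]
  have hle : ∀ w : {w : Fin 2 → ZMod p // aeval w f = 0},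
      Fintype.card {v : Fin 2 → ZMod (p ^ 2) // aeval v f = 0 ∧ redSq p ∘ v = w.1} ≤
        p + if aeval w.1 (pderiv 0 f) = 0 ∧ aeval w.1 (pderiv 1 f) = 0 then p ^ 2 else 0 := by
    intro w
    split_ifs with h
    · exact (card_lifts_le_sq f w.1).trans (Nat.le_add_left _ _)
    · rw [add_zero]
      obtain h | h := not_and_or.1 h
      · exact card_lifts_le_of_pderiv_ne_zero f w.1 0 h
      · exact card_lifts_le_of_pderiv_ne_zero f w.1 1 h
  refine (Finset.sum_le_sum fun w _ => hle w).trans (le_of_eq ?_)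
  rw [Finset.sum_add_distrib, Finset.sum_const, Finset.card_univ, smul_eq_mul, mul_comm,
    ← Finset.sum_filter, Finset.sum_const, smul_eq_mul, mul_comm (p ^ 2), ← Fintype.card_subtype,
    Fintype.card_congr (Equiv.subtypeSubtypeEquivSubtypeInter
      (fun w : Fin 2 → ZMod p => aeval w f = 0)
      (fun w => aeval w (pderiv 0 f) = 0 ∧ aeval w (pderiv 1 f) = 0))]

theorem card_singular_le {f : MvPolynomial (Fin 2) ℤ} {a b : MvPolynomial (Fin 1) ℤ}
    (ha : map (Int.castRingHom (ZMod p)) a ≠ 0) (hb : map (Int.castRingHom (ZMod p)) b ≠ 0)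
    (hfa : ∀ w : Fin 2 → ZMod p,
      aeval w f = 0 → aeval w (pderiv 0 f) = 0 → aeval (fun _ => w 1) a = 0)
    (hfb : ∀ w : Fin 2 → ZMod p,
      aeval w f = 0 → aeval w (pderiv 1 f) = 0 → aeval (fun _ => w 0) b = 0) :
    Fintype.card {w : Fin 2 → ZMod p //
        aeval w f = 0 ∧ aeval w (pderiv 0 f) = 0 ∧ aeval w (pderiv 1 f) = 0} ≤
      a.totalDegree * b.totalDegree := by
  let F : {w : Fin 2 → ZMod p //
        aeval w f = 0 ∧ aeval w (pderiv 0 f) = 0 ∧ aeval w (pderiv 1 f) = 0} →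
      {x : Fin 1 → ZMod p // aeval x a = 0} × {x : Fin 1 → ZMod p // aeval x b = 0} := fun w =>
    (⟨fun _ => w.1 1, hfa w.1 w.2.1 w.2.2.1⟩, ⟨fun _ => w.1 0, hfb w.1 w.2.1 w.2.2.2⟩)
  have hF : Function.Injective F := by
    rintro ⟨w, hw⟩ ⟨w', hw'⟩ h
    have h1 : w 1 = w' 1 := congrArg (fun x => x.1.1 0) h
    have h0 : w 0 = w' 0 := congrArg (fun x => x.2.1 0) h
    apply Subtype.ext
    ext i
    fin_cases i <;> assumption
  have h := Fintype.card_le_of_injective F hF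
  rw [Fintype.card_prod] at h
  exact h.trans (Nat.mul_le_mul (by simpa using card_zeros_le ha) (by simpa using card_zeros_le hb))

theorem card_GL_zeros_le (f : MvPolynomial (Fin 2) ℤ) :
    Nat.card {g : GL (Fin 2) (ZMod (p ^ 2)) |
      aeval ![Matrix.trace (g : Matrix (Fin 2) (Fin 2) (ZMod (p ^ 2))),
        Matrix.det (g : Matrix (Fin 2) (Fin 2) (ZMod (p ^ 2)))] f = 0} ≤
      Fintype.card {v : Fin 2 → ZMod (p ^ 2) // aeval v f = 0} * (3 * p ^ 4) := by
  let F : {g : GL (Fin 2) (ZMod (p ^ 2)) |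
      aeval ![Matrix.trace (g : Matrix (Fin 2) (Fin 2) (ZMod (p ^ 2))),
        Matrix.det (g : Matrix (Fin 2) (Fin 2) (ZMod (p ^ 2)))] f = 0} →
      Σ v : {v : Fin 2 → ZMod (p ^ 2) // aeval v f = 0},
        {M : Matrix (Fin 2) (Fin 2) (ZMod (p ^ 2)) // M.trace = v.1 0 ∧ M.det = v.1 1} := fun g =>
    ⟨⟨_, g.2⟩, ⟨g.1, rfl, rfl⟩⟩
  have hF : Function.Injective F := fun g g' h =>
    Subtype.ext (Units.ext (congrArg (fun x => x.2.1) h))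
  refine (Nat.card_le_card_of_injective F hF).trans ?_
  rw [Nat.card_eq_fintype_card, Fintype.card_sigma]
  refine (Finset.sum_le_sum fun v _ => card_trace_det_le _ _).trans (le_of_eq ?_)
  rw [Finset.sum_const, Finset.card_univ, smul_eq_mul]

end Counting

theorem stmt_7 (f : MvPolynomial (Fin 2) ℤ) (hsf : Squarefree f)
    (hnc : 1 ≤ f.totalDegree) :
    ∃ C : ℝ, 0 < C ∧ ∀ p : ℕ, p.Prime →
      (Nat.card {g : GL (Fin 2) (ZMod (p ^ 2)) |
          MvPolynomial.aeval
            ![Matrix.trace (g : Matrix (Fin 2) (Fin 2) (ZMod (p ^ 2))),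
              Matrix.det (g : Matrix (Fin 2) (Fin 2) (ZMod (p ^ 2)))] f = 0} : ℝ) ≤
        C * (p : ℝ) ^ 6 := by
  obtain ⟨a, ha, hfa⟩ := exists_eliminant_pderiv_zero hsf
  obtain ⟨b, hb, hfb⟩ := exists_eliminant_pderiv_one hsf
  obtain ⟨Bf, hBf⟩ := exists_forall_map_zmod_ne_zero hsf.ne_zero
  obtain ⟨Ba, hBa⟩ := exists_forall_map_zmod_ne_zero ha
  obtain ⟨Bb, hBb⟩ := exists_forall_map_zmod_ne_zero hb
  set B := Bf + Ba + Bb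
  set D := f.totalDegree + a.totalDegree * b.totalDegree
  refine ⟨((3 * (D + B ^ 2) : ℕ) : ℝ), by exact_mod_cast (by positivity), fun p hp => ?_⟩
  have : Fact p.Prime := ⟨hp⟩
  suffices h : Fintype.card {v : Fin 2 → ZMod (p ^ 2) // aeval v f = 0} ≤ (D + B ^ 2) * p ^ 2 by
    have := (card_GL_zeros_le (p := p) f).trans (Nat.mul_le_mul_right _ h)
    rw [show (D + B ^ 2) * p ^ 2 * (3 * p ^ 4) = 3 * (D + B ^ 2) * p ^ 6 by ring] at this
    exact_mod_cast this
  obtain hpB | hpB := le_or_gt p B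
  · calc _ ≤ Fintype.card (Fin 2 → ZMod (p ^ 2)) := Fintype.card_subtype_le _
      _ = p ^ 2 * p ^ 2 := by simp; ring
      _ ≤ B ^ 2 * p ^ 2 := Nat.mul_le_mul_right _ (Nat.pow_le_pow_left hpB 2)
      _ ≤ _ := Nat.mul_le_mul_right _ (Nat.le_add_left _ _)
  · have hZ := card_zeros_le (hBf p (by omega))
    have hS := card_singular_le (hBa p (by omega)) (hBb p (by omega)) (hfa (ZMod p)) (hfb (ZMod p))
    calc _ ≤ _ := card_zeros_sq_le f
      _ ≤ p * (f.totalDegree * p ^ 1) + p ^ 2 * (a.totalDegree * b.totalDegree) := by gcongr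
      _ = D * p ^ 2 := by simp only [D]; ring
      _ ≤ _ := Nat.mul_le_mul_right _ (Nat.le_add_right _ _)
end

section
/- Let f(x,y) ∈ ℤ[x,y] be a squarefree, non-constant polynomial in two variables. Then for every ε > 0 there exists a constant C > 0 (depending only on f and ε) such that for every squarefree positive integer n, |C_f(n²)| / |GL₂(ℤ/n²ℤ)| ≤ C / n^{2 − ε}. -/
open Matrix MvPolynomial

/-- The set `C_f(n)` of matrices `g ∈ GL₂(ℤ/nℤ)` with `f(tr g, det g) ≡ 0 (mod n)`. -/
def Cf (f : MvPolynomial (Fin 2) ℤ) (n : ℕ) : Set (GL (Fin 2) (ZMod n)) :=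
  {g | MvPolynomial.aeval
      ![Matrix.trace (g : Matrix (Fin 2) (Fin 2) (ZMod n)),
        Matrix.det (g : Matrix (Fin 2) (Fin 2) (ZMod n))] f = 0}

open scoped nonZeroDivisors

namespace Polynomial

theorem squarefree_map_fractionRing {R : Type*} [CommRing R] [IsDomain R]
    [UniqueFactorizationMonoid R] {F : R[X]} (hF : Squarefree F) :
    Squarefree (F.map (algebraMap R (FractionRing R))) := by
  classical
  let : NormalizedGCDMonoid R := Nonempty.some inferInstance
  intro q hq
  have hF0 : F.map (algebraMap R (FractionRing R)) ≠ 0 :=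
    (Polynomial.map_ne_zero_iff (IsFractionRing.injective R (FractionRing R))).2 hF.ne_zero
  have hq0 : q ≠ 0 := by
    rintro rfl
    exact hF0 (by simpa using hq)
  obtain ⟨b, hb, hbq⟩ := IsLocalization.integerNormalization_spec R⁰ q
  set N := IsLocalization.integerNormalization R⁰ q
  refine isUnit_or_eq_zero_of_isUnit_integerNormalization_primPart (R := R) hq0 (hF _ ?_)
  have hprim : (N.primPart * N.primPart).IsPrimitive :=
    N.isPrimitive_primPart.mul N.isPrimitive_primPart
  refine hprim.dvd_of_fraction_map_dvd_fraction_map (K := FractionRing R) ?_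
  have hb0 : algebraMap R (FractionRing R) b ≠ 0 := by
    simpa using nonZeroDivisors.ne_zero hb
  have hN : N.primPart.map (algebraMap R (FractionRing R)) ∣ q := by
    have h1 : N.primPart.map (algebraMap R (FractionRing R)) ∣
        N.map (algebraMap R (FractionRing R)) := Polynomial.map_dvd _ N.primPart_dvd
    rw [hbq, Algebra.smul_def, algebraMap_apply] at h1
    exact (IsUnit.dvd_mul_left (isUnit_C.2 hb0.isUnit)).1 h1
  rw [Polynomial.map_mul]
  exact (mul_dvd_mul hN hN).trans hq

theorem exists_mul_add_mul_derivative_eq_C {R : Type*} [CommRing R] [IsDomain R]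
    [UniqueFactorizationMonoid R] [CharZero R] {F : R[X]} (hF : Squarefree F) :
    ∃ (A B : R[X]) (r : R), r ≠ 0 ∧ A * F + B * derivative F = C r := by
  have hsep : (F.map (algebraMap R (FractionRing R))).Separable :=
    PerfectField.separable_iff_squarefree.2 (squarefree_map_fractionRing hF)
  obtain ⟨a, b, hab⟩ := hsep
  obtain ⟨c, hc, hca⟩ := IsLocalization.integerNormalization_spec R⁰ a
  obtain ⟨d, hd, hdb⟩ := IsLocalization.integerNormalization_spec R⁰ b
  refine ⟨C d * IsLocalization.integerNormalization R⁰ a,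
    C c * IsLocalization.integerNormalization R⁰ b, c * d,
    mul_ne_zero (nonZeroDivisors.ne_zero hc) (nonZeroDivisors.ne_zero hd), ?_⟩
  apply Polynomial.map_injective _ (IsFractionRing.injective R (FractionRing R))
  rw [Algebra.smul_def, algebraMap_apply] at hca hdb
  simp only [Polynomial.map_add, Polynomial.map_mul, hca, hdb, Polynomial.map_C, map_mul,
    ← derivative_map]
  linear_combination (C (algebraMap R (FractionRing R) c) *
    C (algebraMap R (FractionRing R) d)) * hab

theorem aevalAeval_add_of_sq_eq_zero {A : Type*} [CommRing A] (F : ℤ[X][X]) (x y h : A)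
    (hh : h ^ 2 = 0) :
    F.aevalAeval x (y + h) = F.aevalAeval x y + (derivative F).aevalAeval x y * h := by
  have key (G : ℤ[X][X]) (z : A) :
      G.aevalAeval x z = (G.map (aeval (R := ℤ) x).toRingHom).eval z := by
    rw [eval_map]
    have : (aevalAeval (R := ℤ) x z).toRingHom = eval₂RingHom (aeval (R := ℤ) x).toRingHom z := by
      ext <;> simp
    exact congrArg (fun φ : ℤ[X][X] →+* A => φ G) this
  rw [key, key, key, eval_add_of_sq_eq_zero _ _ _ hh, derivative_map]

theorem map_aevalAeval {A B : Type*} [CommRing A] [CommRing B] (π : A →+* B) (x y : A)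
    (F : ℤ[X][X]) : π (F.aevalAeval x y) = F.aevalAeval (π x) (π y) := by
  have : (π.toIntAlgHom.comp (aevalAeval (R := ℤ) x y)) = aevalAeval (π x) (π y) := by
    ext <;> simp
  exact congrArg (fun φ : ℤ[X][X] →ₐ[ℤ] B => φ F) this

theorem mvPolynomial_aeval_eq_aevalAeval {A : Type*} [CommRing A] (x y : A)
    (f : MvPolynomial (Fin 2) ℤ) : MvPolynomial.aeval ![x, y] f =
      ((Bivariate.equivMvPolynomial ℤ).symm f).aevalAeval x y := by
  have : MvPolynomial.aeval ![x, y] =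
      (aevalAeval (R := ℤ) x y).comp (Bivariate.equivMvPolynomial ℤ).symm.toAlgHom := by
    ext i
    fin_cases i <;> simp
  exact congrArg (fun φ : MvPolynomial (Fin 2) ℤ →ₐ[ℤ] A => φ f) this

end Polynomial

namespace ZMod

section PrimeSquare

variable {p : ℕ} [Fact p.Prime]

/-- Reduction modulo `p` on `ℤ/p²ℤ`. -/
def redPrime (p : ℕ) : ZMod (p ^ 2) →+* ZMod p :=
  ZMod.castHom (dvd_pow_self p two_ne_zero) (ZMod p)

/-- The second base-`p` digit of a residue class modulo `p²`. -/
def highDigit (x : ZMod (p ^ 2)) : ZMod p := ((x.val / p : ℕ) : ZMod p)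

theorem redPrime_eq_natCast_val (x : ZMod (p ^ 2)) : redPrime p x = (x.val : ZMod p) := by
  conv_lhs => rw [← ZMod.natCast_zmod_val x]
  exact map_natCast _ _

theorem eq_of_redPrime_eq_of_highDigit_eq {x y : ZMod (p ^ 2)} (h : redPrime p x = redPrime p y)
    (h' : highDigit x = highDigit y) : x = y := by
  rw [redPrime_eq_natCast_val, redPrime_eq_natCast_val, ZMod.natCast_eq_natCast_iff'] at h
  have hlt (z : ZMod (p ^ 2)) : z.val / p < p :=
    Nat.div_lt_of_lt_mul (by rw [← sq]; exact ZMod.val_lt z)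
  rw [highDigit, highDigit, ZMod.natCast_eq_natCast_iff', Nat.mod_eq_of_lt (hlt x),
    Nat.mod_eq_of_lt (hlt y)] at h'
  apply ZMod.val_injective
  rw [← Nat.div_add_mod x.val p, ← Nat.div_add_mod y.val p, h, h']

theorem sq_eq_zero_of_redPrime_eq_zero {x : ZMod (p ^ 2)} (h : redPrime p x = 0) :
    x ^ 2 = 0 := by
  rw [redPrime_eq_natCast_val, ZMod.natCast_eq_zero_iff] at h
  rw [← ZMod.natCast_zmod_val x, ← Nat.cast_pow, ZMod.natCast_eq_zero_iff]
  exact pow_dvd_pow_of_dvd h 2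

theorem isUnit_of_redPrime_ne_zero {x : ZMod (p ^ 2)} (h : redPrime p x ≠ 0) : IsUnit x := by
  rw [redPrime_eq_natCast_val, Ne, ZMod.natCast_eq_zero_iff] at h
  rw [← ZMod.natCast_zmod_val x, ZMod.isUnit_iff_coprime]
  exact (((Fact.out : p.Prime).coprime_iff_not_dvd.2 h).symm).pow_right 2

open scoped Classical in
theorem card_mul_eq_le (m : ZMod (p ^ 2)) :
    (Finset.univ.filter fun z : ZMod (p ^ 2) × ZMod (p ^ 2) => z.1 * z.2 = m).card ≤
      3 * p ^ 2 := by
  set S := Finset.univ.filter fun z : ZMod (p ^ 2) × ZMod (p ^ 2) => z.1 * z.2 = m with hS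
  have hcover : S ⊆ (S.filter fun z => redPrime p z.1 ≠ 0) ∪ ((S.filter fun z => z.1 = 0) ∪
      (S.filter fun z => redPrime p z.1 = 0 ∧ z.1 ≠ 0)) := by
    intro z hz
    simp only [Finset.mem_union, Finset.mem_filter, hz, true_and]
    tauto
  have hunit : (S.filter fun z => redPrime p z.1 ≠ 0).card ≤ p ^ 2 := by
    refine (Finset.card_le_card_of_injOn (t := Finset.univ) Prod.fst (by simp) ?_).trans_eq
      (by simp [ZMod.card])
    rintro ⟨b, c⟩ hbc ⟨b', c'⟩ hbc' (rfl : b = b')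
    simp only [hS, Finset.coe_filter, Finset.mem_filter, Finset.mem_univ, true_and,
      Set.mem_ofPred_eq] at hbc hbc'
    rw [(isUnit_of_redPrime_ne_zero hbc.2).mul_left_cancel (hbc.1.trans hbc'.1.symm)]
  have hzero : (S.filter fun z => z.1 = 0).card ≤ p ^ 2 := by
    refine (Finset.card_le_card_of_injOn (t := Finset.univ) Prod.snd (by simp) ?_).trans_eq
      (by simp [ZMod.card])
    rintro ⟨b, c⟩ hbc ⟨b', c'⟩ hbc' (rfl : c = c')
    simp only [hS, Finset.coe_filter, Finset.mem_filter, Finset.mem_univ, true_and,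
      Set.mem_ofPred_eq] at hbc hbc'
    rw [hbc.2, hbc'.2]
  have hrest : (S.filter fun z => redPrime p z.1 = 0 ∧ z.1 ≠ 0).card ≤ p ^ 2 := by
    refine (Finset.card_le_card_of_injOn (t := Finset.univ)
      (fun z => (highDigit z.1, highDigit z.2)) (by simp) ?_).trans_eq (by simp [ZMod.card, sq])
    rintro ⟨b, c⟩ hbc ⟨b', c'⟩ hbc' hdig
    simp only [hS, Finset.coe_filter, Finset.mem_filter, Finset.mem_univ, true_and,
      Set.mem_ofPred_eq] at hbc hbc'
    simp only [Prod.mk.injEq] at hdig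
    obtain rfl : b = b' :=
      eq_of_redPrime_eq_of_highDigit_eq (hbc.2.1.trans hbc'.2.1.symm) hdig.1
    have hred : redPrime p c = redPrime p c' := by
      by_contra hne
      have hu : IsUnit (c - c') :=
        isUnit_of_redPrime_ne_zero (by rwa [map_sub, sub_ne_zero])
      refine hbc.2.2 (hu.mul_left_eq_zero.1 ?_)
      rw [mul_sub, hbc.1, hbc'.1, sub_self]
    rw [eq_of_redPrime_eq_of_highDigit_eq hred hdig.2]
  calc S.card ≤ _ := Finset.card_le_card hcover
    _ ≤ _ := Finset.card_union_le _ _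
    _ ≤ _ := Nat.add_le_add_left (Finset.card_union_le _ _) _
    _ ≤ 3 * p ^ 2 := by omega

open Polynomial in
theorem eq_of_aevalAeval_eq_zero (F : ℤ[X][X]) {x y y' : ZMod (p ^ 2)}
    (h : F.aevalAeval x y = 0) (h' : F.aevalAeval x y' = 0) (hred : redPrime p y = redPrime p y')
    (hd : (derivative F).aevalAeval (redPrime p x) (redPrime p y) ≠ 0) : y = y' := by
  have hsq : (y' - y) ^ 2 = 0 :=
    sq_eq_zero_of_redPrime_eq_zero (by rw [map_sub, hred, sub_self])
  have hu : IsUnit ((derivative F).aevalAeval x y) :=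
    isUnit_of_redPrime_ne_zero (by rwa [map_aevalAeval])
  have htaylor := aevalAeval_add_of_sq_eq_zero F x y (y' - y) hsq
  rw [add_sub_cancel, h, h', zero_add] at htaylor
  exact (sub_eq_zero.1 (hu.mul_right_eq_zero.1 htaylor.symm)).symm

open scoped Classical in
/-- The zeros in `A × A` of a bivariate integer polynomial. -/
noncomputable def bivariateZeros (F : Polynomial (Polynomial ℤ)) (A : Type*) [CommRing A]
    [Fintype A] : Finset (A × A) :=
  Finset.univ.filter fun z => F.aevalAeval z.1 z.2 = 0

open scoped Classical in
/-- The zeros in `A × A` at which both partial derivatives vanish. -/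
noncomputable def bivariateSingularZeros (F : Polynomial (Polynomial ℤ)) (A : Type*) [CommRing A]
    [Fintype A] : Finset (A × A) :=
  (bivariateZeros F A).filter fun z =>
    (Polynomial.derivative F).aevalAeval z.1 z.2 = 0 ∧
      (Polynomial.derivative (Polynomial.Bivariate.swap F)).aevalAeval z.2 z.1 = 0

theorem mem_bivariateZeros {F : Polynomial (Polynomial ℤ)} {A : Type*} [CommRing A]
    [Fintype A] {z : A × A} : z ∈ bivariateZeros F A ↔ F.aevalAeval z.1 z.2 = 0 := by
  simp [bivariateZeros]

open Polynomial in
open scoped Classical in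
theorem card_bivariateZeros_sq_le (F : ℤ[X][X]) :
    (bivariateZeros F (ZMod (p ^ 2))).card ≤
      2 * ((bivariateZeros F (ZMod p)).card * p) +
        (bivariateSingularZeros F (ZMod p)).card * p ^ 2 := by
  set Z := bivariateZeros F (ZMod (p ^ 2)) with hZ
  have hred {z : ZMod (p ^ 2) × ZMod (p ^ 2)} (hz : z ∈ Z) :
      (redPrime p z.1, redPrime p z.2) ∈ bivariateZeros F (ZMod p) := by
    rw [hZ, mem_bivariateZeros] at hz
    rw [mem_bivariateZeros, ← map_aevalAeval, hz, map_zero]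
  let P (z : ZMod (p ^ 2) × ZMod (p ^ 2)) : Prop :=
    (derivative F).aevalAeval (redPrime p z.1) (redPrime p z.2) = 0
  let Q (z : ZMod (p ^ 2) × ZMod (p ^ 2)) : Prop :=
    (derivative (Bivariate.swap F)).aevalAeval (redPrime p z.2) (redPrime p z.1) = 0
  have hcover : Z ⊆ (Z.filter fun z => ¬ P z) ∪ ((Z.filter fun z => ¬ Q z) ∪
      (Z.filter fun z => P z ∧ Q z)) := by
    intro z hz
    simp only [Finset.mem_union, Finset.mem_filter, hz, true_and]
    tauto
  have hP : (Z.filter fun z => ¬ P z).card ≤ (bivariateZeros F (ZMod p)).card * p := by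
    refine (Finset.card_le_card_of_injOn (t := bivariateZeros F (ZMod p) ×ˢ Finset.univ)
      (fun z => ((redPrime p z.1, redPrime p z.2), highDigit z.1)) ?_ ?_).trans_eq
      (by simp [ZMod.card])
    · intro z hz
      simpa using hred (Finset.mem_filter.1 hz).1
    · rintro ⟨x, y⟩ hz ⟨x', y'⟩ hz' hxy
      simp only [Prod.mk.injEq] at hxy
      obtain rfl : x = x' := eq_of_redPrime_eq_of_highDigit_eq hxy.1.1 hxy.2
      obtain ⟨hz, hd⟩ := Finset.mem_filter.1 hz
      have h1 := mem_bivariateZeros.1 hz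
      have h2 := mem_bivariateZeros.1 (Finset.mem_filter.1 hz').1
      obtain rfl : y = y' := eq_of_aevalAeval_eq_zero F h1 h2 hxy.1.2 hd
      rfl
  have hQ : (Z.filter fun z => ¬ Q z).card ≤ (bivariateZeros F (ZMod p)).card * p := by
    refine (Finset.card_le_card_of_injOn (t := bivariateZeros F (ZMod p) ×ˢ Finset.univ)
      (fun z => ((redPrime p z.1, redPrime p z.2), highDigit z.2)) ?_ ?_).trans_eq
      (by simp [ZMod.card])
    · intro z hz
      simpa using hred (Finset.mem_filter.1 hz).1
    · rintro ⟨x, y⟩ hz ⟨x', y'⟩ hz' hxy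
      simp only [Prod.mk.injEq] at hxy
      obtain rfl : y = y' := eq_of_redPrime_eq_of_highDigit_eq hxy.1.2 hxy.2
      obtain ⟨hz, hd⟩ := Finset.mem_filter.1 hz
      have h1 := mem_bivariateZeros.1 hz
      have h2 := mem_bivariateZeros.1 (Finset.mem_filter.1 hz').1
      rw [← Bivariate.aevalAeval_swap] at h1 h2
      obtain rfl : x = x' := eq_of_aevalAeval_eq_zero (Bivariate.swap F) h1 h2 hxy.1.1 hd
      rfl
  have hPQ : (Z.filter fun z => P z ∧ Q z).card ≤
      (bivariateSingularZeros F (ZMod p)).card * p ^ 2 := by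
    refine (Finset.card_le_card_of_injOn
      (t := bivariateSingularZeros F (ZMod p) ×ˢ (Finset.univ ×ˢ Finset.univ))
      (fun z => ((redPrime p z.1, redPrime p z.2), (highDigit z.1, highDigit z.2))) ?_ ?_).trans_eq
      (by simp [ZMod.card, sq])
    · intro z hz
      obtain ⟨hz, hPz, hQz⟩ := Finset.mem_filter.1 hz
      simpa [bivariateSingularZeros] using ⟨hred hz, hPz, hQz⟩
    · rintro ⟨x, y⟩ - ⟨x', y'⟩ - hxy
      simp only [Prod.mk.injEq] at hxy
      rw [eq_of_redPrime_eq_of_highDigit_eq hxy.1.1 hxy.2.1,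
        eq_of_redPrime_eq_of_highDigit_eq hxy.1.2 hxy.2.2]
  calc Z.card ≤ _ := Finset.card_le_card hcover
    _ ≤ _ := Finset.card_union_le _ _
    _ ≤ _ := Nat.add_le_add_left (Finset.card_union_le _ _) _
    _ ≤ _ := by omega

end PrimeSquare

theorem intCast_ne_zero_of_natAbs_lt {p : ℕ} {a : ℤ} (ha : a ≠ 0) (hp : a.natAbs < p) :
    (a : ZMod p) ≠ 0 := by
  rw [Ne, ZMod.intCast_zmod_eq_zero_iff_dvd]
  intro h
  exact ha (Int.eq_zero_of_dvd_of_natAbs_lt_natAbs h (by simpa using hp))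

/-- A nonzero integer polynomial has boundedly many roots modulo all large primes. -/
theorem exists_finset_aeval_eq_zero {r : Polynomial ℤ} (hr : r ≠ 0) {p : ℕ} [Fact p.Prime]
    (hp : r.leadingCoeff.natAbs < p) :
    ∃ T : Finset (ZMod p), T.card ≤ r.natDegree ∧ ∀ x, Polynomial.aeval x r = 0 → x ∈ T := by
  classical
  have hmap : r.map (algebraMap ℤ (ZMod p)) ≠ 0 := by
    intro h
    refine intCast_ne_zero_of_natAbs_lt (Polynomial.leadingCoeff_ne_zero.2 hr) hp ?_
    simpa using congrArg (fun q => Polynomial.coeff q r.natDegree) h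
  refine ⟨(r.map (algebraMap ℤ (ZMod p))).roots.toFinset,
    (Multiset.toFinset_card_le _).trans
      ((Polynomial.card_roots' _).trans Polynomial.natDegree_map_le), fun x hx => ?_⟩
  rw [Multiset.mem_toFinset, Polynomial.mem_roots hmap, Polynomial.IsRoot,
    Polynomial.eval_map_algebraMap]
  exact hx

theorem exists_card_bivariateSingularZeros_le {F : Polynomial (Polynomial ℤ)}
    (hF : Squarefree F) : ∃ K N : ℕ, ∀ (p : ℕ) [Fact p.Prime], N < p →
      (bivariateSingularZeros F (ZMod p)).card ≤ K := by
  classical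
  obtain ⟨A, B, r, hr, hAB⟩ := Polynomial.exists_mul_add_mul_derivative_eq_C hF
  have hF' : Squarefree (Polynomial.Bivariate.swap F) := by
    intro q hq
    have := hF (Polynomial.Bivariate.swap q) (by
      simpa [Polynomial.Bivariate.swap_swap_apply] using
        map_dvd (Polynomial.Bivariate.swap (R := ℤ)) hq)
    simpa using this
  obtain ⟨A', B', s, hs, hAB'⟩ := Polynomial.exists_mul_add_mul_derivative_eq_C hF'
  refine ⟨r.natDegree * s.natDegree, max r.leadingCoeff.natAbs s.leadingCoeff.natAbs,
    fun p _ hp => ?_⟩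
  obtain ⟨T, hT, hrT⟩ := exists_finset_aeval_eq_zero hr ((le_max_left _ _).trans_lt hp)
  obtain ⟨U, hU, hsU⟩ := exists_finset_aeval_eq_zero hs ((le_max_right _ _).trans_lt hp)
  have hsub : bivariateSingularZeros F (ZMod p) ⊆ T ×ˢ U := by
    rintro ⟨x, y⟩ hxy
    simp only [bivariateSingularZeros, Finset.mem_filter, mem_bivariateZeros] at hxy
    obtain ⟨h0, hy, hx⟩ := hxy
    refine Finset.mem_product.2 ⟨hrT _ ?_, hsU _ ?_⟩
    · have := congrArg (Polynomial.aevalAeval (R := ℤ) x y) hAB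
      rw [map_add, map_mul, map_mul, h0, hy, Polynomial.aevalAeval_C] at this
      simpa using this.symm
    · have := congrArg (Polynomial.aevalAeval (R := ℤ) y x) hAB'
      rw [map_add, map_mul, map_mul, Polynomial.Bivariate.aevalAeval_swap, h0, hx,
        Polynomial.aevalAeval_C] at this
      simpa using this.symm
  calc _ ≤ _ := Finset.card_le_card hsub
    _ = T.card * U.card := Finset.card_product _ _
    _ ≤ _ := Nat.mul_le_mul hT hU

theorem exists_card_bivariateZeros_le {f : MvPolynomial (Fin 2) ℤ} (hf : f ≠ 0) :
    ∃ K N : ℕ, ∀ (p : ℕ) [Fact p.Prime], N < p →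
      (bivariateZeros ((Polynomial.Bivariate.equivMvPolynomial ℤ).symm f) (ZMod p)).card ≤
        K * p := by
  classical
  obtain ⟨m, hm⟩ := MvPolynomial.ne_zero_iff.1 hf
  refine ⟨f.totalDegree, (f.coeff m).natAbs, fun p _ hp => ?_⟩
  have hmap : MvPolynomial.map (algebraMap ℤ (ZMod p)) f ≠ 0 := by
    intro h
    refine intCast_ne_zero_of_natAbs_lt hm hp ?_
    simpa [MvPolynomial.coeff_map] using congrArg (MvPolynomial.coeff m) h
  have hp0 : (0 : ℚ≥0) < p := by exact_mod_cast (Fact.out : p.Prime).pos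
  have hSZ := MvPolynomial.schwartz_zippel_totalDegree hmap Finset.univ
  rw [Finset.card_univ, ZMod.card, div_le_div_iff₀ (pow_pos hp0 2) hp0, sq, ← mul_assoc,
    mul_le_mul_iff_left₀ hp0] at hSZ
  have hcard : (bivariateZeros ((Polynomial.Bivariate.equivMvPolynomial ℤ).symm f)
      (ZMod p)).card ≤ ((Fintype.piFinset fun _ : Fin 2 => (Finset.univ : Finset (ZMod p))).filter
        fun z => MvPolynomial.eval z (MvPolynomial.map (algebraMap ℤ (ZMod p)) f) = 0).card := by
    refine Finset.card_le_card_of_injOn (fun z => ![z.1, z.2]) ?_ ?_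
    · intro z hz
      have := mem_bivariateZeros.1 hz
      rw [← Polynomial.mvPolynomial_aeval_eq_aevalAeval] at this
      simpa [MvPolynomial.eval_map, MvPolynomial.aeval_def] using this
    · rintro ⟨x, y⟩ - ⟨x', y'⟩ - h
      have h0 := congrFun h 0
      have h1 := congrFun h 1
      simp_all
  have hdeg : (MvPolynomial.map (algebraMap ℤ (ZMod p)) f).totalDegree ≤ f.totalDegree :=
    Finset.sup_mono (MvPolynomial.support_map_subset _ _)
  have : (((Fintype.piFinset fun _ : Fin 2 => (Finset.univ : Finset (ZMod p))).filter
        fun z => MvPolynomial.eval z (MvPolynomial.map (algebraMap ℤ (ZMod p)) f) = 0).card) ≤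
      (MvPolynomial.map (algebraMap ℤ (ZMod p)) f).totalDegree * p := by exact_mod_cast hSZ
  exact hcard.trans (this.trans (Nat.mul_le_mul_right _ hdeg))

theorem exists_card_bivariateZeros_sq_le {f : MvPolynomial (Fin 2) ℤ} (hf : Squarefree f) :
    ∃ K : ℕ, ∀ (p : ℕ) [Fact p.Prime],
      (bivariateZeros ((Polynomial.Bivariate.equivMvPolynomial ℤ).symm f)
        (ZMod (p ^ 2))).card ≤ K * p ^ 2 := by
  have hF : Squarefree ((Polynomial.Bivariate.equivMvPolynomial ℤ).symm f) := by
    intro q hq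
    have := hf (Polynomial.Bivariate.equivMvPolynomial ℤ q) (by
      simpa using map_dvd (Polynomial.Bivariate.equivMvPolynomial ℤ) hq)
    simpa using this
  obtain ⟨K₁, N₁, h₁⟩ := exists_card_bivariateSingularZeros_le hF
  obtain ⟨K₂, N₂, h₂⟩ := exists_card_bivariateZeros_le hf.ne_zero
  refine ⟨2 * K₂ + K₁ + (N₁ + N₂) ^ 2, fun p _ => ?_⟩
  by_cases hp : N₁ + N₂ < p
  · have h₁ := h₁ p (by omega)
    have h₂ := h₂ p (by omega)
    calc _ ≤ _ := card_bivariateZeros_sq_le _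
      _ ≤ 2 * (K₂ * p * p) + K₁ * p ^ 2 := by gcongr
      _ = (2 * K₂ + K₁) * p ^ 2 := by ring
      _ ≤ _ := Nat.mul_le_mul_right _ (Nat.le_add_right _ _)
  · calc _ ≤ (Finset.univ : Finset (ZMod (p ^ 2) × ZMod (p ^ 2))).card :=
          Finset.card_le_card (Finset.subset_univ _)
      _ = p ^ 2 * p ^ 2 := by simp [ZMod.card]
      _ ≤ (N₁ + N₂) ^ 2 * p ^ 2 := by gcongr; omega
      _ ≤ _ := by gcongr; omega

end ZMod

theorem card_GL_two_ge (n : ℕ) [NeZero n] :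
    n ^ 2 * n.totient ^ 2 ≤ Nat.card (GL (Fin 2) (ZMod n)) := by
  let φ : (ZMod n)ˣ × ZMod n × ZMod n × (ZMod n)ˣ → GL (Fin 2) (ZMod n) := fun z =>
    Matrix.GeneralLinearGroup.mk''
      !![(z.1 : ZMod n), z.2.1;
        z.2.2.1, ((z.1⁻¹ : (ZMod n)ˣ) : ZMod n) * (z.2.1 * z.2.2.1 + z.2.2.2)]
      (by simp [Matrix.det_fin_two_of])
  have hφ : Function.Injective φ := by
    rintro ⟨u, b, c, v⟩ ⟨u', b', c', v'⟩ h
    have hval := congrArg (fun g : GL (Fin 2) (ZMod n) => (g : Matrix (Fin 2) (Fin 2) (ZMod n))) h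
    have h00 : (u : ZMod n) = u' := congrFun (congrFun hval 0) 0
    obtain rfl := Units.ext h00
    obtain rfl : b = b' := congrFun (congrFun hval 0) 1
    obtain rfl : c = c' := congrFun (congrFun hval 1) 0
    have h11 : ((u⁻¹ : (ZMod n)ˣ) : ZMod n) * (b * c + v) =
      ((u⁻¹ : (ZMod n)ˣ) : ZMod n) * (b * c + v') := congrFun (congrFun hval 1) 1
    obtain rfl : v = v' := Units.ext (add_left_cancel ((Units.mul_right_inj _).1 h11))
    rfl
  refine le_trans (le_of_eq ?_) (Nat.card_le_card_of_injective φ hφ)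
  simp only [Nat.card_eq_fintype_card, Fintype.card_prod, ZMod.card,
    ZMod.card_units_eq_totient]
  ring

theorem le_two_pow_card_primeFactors_mul_totient (n : ℕ) :
    n ≤ 2 ^ n.primeFactors.card * n.totient := by
  have h : (n : ℚ) ≤ 2 ^ n.primeFactors.card * n.totient := by
    have hprod : (1 / 2 : ℚ) ^ n.primeFactors.card ≤
        ∏ p ∈ n.primeFactors, (1 - (p : ℚ)⁻¹) := by
      rw [← Finset.prod_const]
      refine Finset.prod_le_prod (fun _ _ => by norm_num) fun p hp => ?_
      have hp2 : (2 : ℚ) ≤ p := by exact_mod_cast (Nat.prime_of_mem_primeFactors hp).two_le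
      have : (p : ℚ)⁻¹ ≤ 2⁻¹ := inv_anti₀ (by norm_num) hp2
      linarith
    rw [Nat.totient_eq_mul_prod_factors]
    calc (n : ℚ) = 2 ^ n.primeFactors.card * (n * (1 / 2) ^ n.primeFactors.card) := by
          rw [mul_left_comm, ← mul_pow]; norm_num
      _ ≤ _ := by gcongr
  exact_mod_cast h

theorem ZMod.eq_of_castHom_eq_of_coprime {m n : ℕ} (h : m.Coprime n) {x y : ZMod (m * n)}
    (hm : ZMod.castHom (dvd_mul_right m n) (ZMod m) x =
      ZMod.castHom (dvd_mul_right m n) (ZMod m) y)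
    (hn : ZMod.castHom (dvd_mul_left n m) (ZMod n) x =
      ZMod.castHom (dvd_mul_left n m) (ZMod n) y) : x = y := by
  obtain ⟨a, rfl⟩ := ZMod.intCast_surjective x
  obtain ⟨b, rfl⟩ := ZMod.intCast_surjective y
  simp only [map_intCast, ZMod.intCast_eq_intCast_iff_dvd_sub] at hm hn ⊢
  push_cast
  exact (Nat.isCoprime_iff_coprime.2 h).mul_dvd hm hn

theorem map_mem_Cf {f : MvPolynomial (Fin 2) ℤ} {m n : ℕ} (π : ZMod m →+* ZMod n)
    {g : GL (Fin 2) (ZMod m)} (hg : g ∈ Cf f m) :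
    Matrix.GeneralLinearGroup.map π g ∈ Cf f n := by
  have h := congrArg π (show MvPolynomial.aeval _ f = 0 from hg)
  rw [Polynomial.mvPolynomial_aeval_eq_aevalAeval, Polynomial.map_aevalAeval,
    ← Polynomial.mvPolynomial_aeval_eq_aevalAeval, map_zero] at h
  change MvPolynomial.aeval _ f = 0
  convert h using 4
  · simp [Matrix.trace_fin_two]
  · simp [Matrix.det_fin_two]

theorem card_Cf_mul_le (f : MvPolynomial (Fin 2) ℤ) {m n : ℕ} [NeZero m] [NeZero n]
    (h : m.Coprime n) :
    Nat.card (Cf f (m * n)) ≤ Nat.card (Cf f m) * Nat.card (Cf f n) := by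
  rw [← Nat.card_prod]
  let φ : Cf f (m * n) → Cf f m × Cf f n := fun g =>
    (⟨_, map_mem_Cf (ZMod.castHom (dvd_mul_right m n) (ZMod m)) g.2⟩,
      ⟨_, map_mem_Cf (ZMod.castHom (dvd_mul_left n m) (ZMod n)) g.2⟩)
  refine Nat.card_le_card_of_injective φ fun g g' hgg => ?_
  have h1 := congrArg (fun z : Cf f m × Cf f n => (z.1 : GL (Fin 2) (ZMod m))) hgg
  have h2 := congrArg (fun z : Cf f m × Cf f n => (z.2 : GL (Fin 2) (ZMod n))) hgg
  ext i j
  exact ZMod.eq_of_castHom_eq_of_coprime h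
    (congrArg (fun g : GL (Fin 2) (ZMod m) => g i j) h1)
    (congrArg (fun g : GL (Fin 2) (ZMod n) => g i j) h2)

theorem exists_card_Cf_prime_sq_le {f : MvPolynomial (Fin 2) ℤ} (hf : Squarefree f) :
    ∃ K : ℕ, ∀ p : ℕ, p.Prime → Nat.card (Cf f (p ^ 2)) ≤ K * p ^ 6 := by
  classical
  obtain ⟨K, hK⟩ := ZMod.exists_card_bivariateZeros_sq_le hf
  refine ⟨3 * K, fun p hp => ?_⟩
  have := Fact.mk hp
  set Z := ZMod.bivariateZeros ((Polynomial.Bivariate.equivMvPolynomial ℤ).symm f) (ZMod (p ^ 2))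
  have hcard : Nat.card (Cf f (p ^ 2)) = (Cf f (p ^ 2)).toFinset.card := by
    rw [Nat.card_eq_fintype_card, Set.toFinset_card]
  have hfib := Finset.card_le_mul_card_image_of_maps_to (s := (Cf f (p ^ 2)).toFinset)
    (t := Z ×ˢ (Finset.univ : Finset (ZMod (p ^ 2))))
    (f := fun g : GL (Fin 2) (ZMod (p ^ 2)) => ((
      Matrix.trace (g : Matrix (Fin 2) (Fin 2) (ZMod (p ^ 2))),
      Matrix.det (g : Matrix (Fin 2) (Fin 2) (ZMod (p ^ 2)))), g 0 0)) ?_ (3 * p ^ 2) ?_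
  · rw [hcard]
    refine hfib.trans ?_
    rw [Finset.card_product, Finset.card_univ, ZMod.card]
    calc 3 * p ^ 2 * (Z.card * p ^ 2) ≤ 3 * p ^ 2 * ((K * p ^ 2) * p ^ 2) := by
          gcongr
          exact hK p
      _ = _ := by ring
  · intro g hg
    rw [Set.mem_toFinset] at hg
    rw [Cf, Set.mem_ofPred_eq, Polynomial.mvPolynomial_aeval_eq_aevalAeval] at hg
    exact Finset.mem_product.2 ⟨ZMod.mem_bivariateZeros.2 hg, Finset.mem_univ _⟩
  · rintro ⟨⟨t, d⟩, a⟩ -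
    refine le_trans ?_ (ZMod.card_mul_eq_le (a * (t - a) - d))
    refine Finset.card_le_card_of_injOn (fun g => (g 0 1, g 1 0)) ?_ ?_
    · intro g hg
      have hg := (Finset.mem_filter.1 hg).2
      simp only [Prod.mk.injEq, Matrix.trace_fin_two, Matrix.det_fin_two] at hg
      obtain ⟨⟨rfl, rfl⟩, rfl⟩ := hg
      simp only [Finset.coe_filter, Finset.mem_univ, true_and, Set.mem_ofPred_eq]
      ring
    · intro g hg g' hg' hbc
      have hg := (Finset.mem_filter.1 hg).2
      have hg' := (Finset.mem_filter.1 hg').2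
      simp only [Prod.mk.injEq, Matrix.trace_fin_two] at hg hg' hbc
      have h00 : g 0 0 = g' 0 0 := hg.2.trans hg'.2.symm
      have h11 : g 1 1 = g' 1 1 :=
        add_left_cancel ((hg.1.1.trans hg'.1.1.symm).trans (by rw [h00]))
      ext i j
      fin_cases i <;> fin_cases j
      exacts [h00, hbc.1, hbc.2, h11]

theorem card_Cf_sq_le {f : MvPolynomial (Fin 2) ℤ} {K : ℕ}
    (hK : ∀ p : ℕ, p.Prime → Nat.card (Cf f (p ^ 2)) ≤ K * p ^ 6) (n : ℕ) (hn : Squarefree n) :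
    Nat.card (Cf f (n ^ 2)) ≤ K ^ n.primeFactors.card * n ^ 6 := by
  induction n using Nat.recOnPosPrimePosCoprime with
  | zero => exact absurd hn not_squarefree_zero
  | one =>
    have : Subsingleton (ZMod (1 ^ 2)) := inferInstanceAs (Subsingleton (ZMod 1))
    simpa using Finite.card_le_one_iff_subsingleton.2 (inferInstance : Subsingleton (Cf f (1 ^ 2)))
  | prime_pow p k hp hk =>
    obtain rfl : k = 1 := by
      rcases (Nat.squarefree_pow_iff hp.ne_one hk.ne').1 hn with ⟨-, rfl⟩
      rfl
    rw [pow_one, hp.primeFactors, Finset.card_singleton, pow_one]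
    exact hK p hp
  | coprime a b ha hb hab iha ihb =>
    have : NeZero (a ^ 2) := ⟨by positivity⟩
    have : NeZero (b ^ 2) := ⟨by positivity⟩
    rw [hab.primeFactors_mul, Finset.card_union_of_disjoint hab.disjoint_primeFactors, mul_pow]
    calc _ ≤ _ := card_Cf_mul_le f (hab.pow 2 2)
      _ ≤ _ := Nat.mul_le_mul (iha hn.of_mul_left) (ihb hn.of_mul_right)
      _ = _ := by ring

theorem exists_pow_card_primeFactors_le (L : ℕ) {ε : ℝ} (hε : 0 < ε) :
    ∃ C : ℝ, 0 < C ∧ ∀ n : ℕ, Squarefree n →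
      (L : ℝ) ^ n.primeFactors.card ≤ C * (n : ℝ) ^ ε := by
  obtain ⟨N, hN⟩ : ∃ N : ℕ, ∀ p : ℕ, N ≤ p → (L : ℝ) ≤ (p : ℝ) ^ ε := by
    have := ((tendsto_rpow_atTop hε).comp tendsto_natCast_atTop_atTop).eventually_ge_atTop (L : ℝ)
    exact Filter.eventually_atTop.1 this
  refine ⟨((L : ℝ) + 1) ^ N, by positivity, fun n hn => ?_⟩
  have hterm : ∀ p ∈ n.primeFactors,
      (L : ℝ) ≤ (if p < N then (L : ℝ) + 1 else 1) * (p : ℝ) ^ ε := by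
    intro p hp
    split_ifs with h
    · have hp1 : (1 : ℝ) ≤ p := by exact_mod_cast (Nat.prime_of_mem_primeFactors hp).one_le
      nlinarith [Real.one_le_rpow hp1 hε.le, (Nat.cast_nonneg L : (0 : ℝ) ≤ L)]
    · rw [one_mul]
      exact hN p (not_lt.1 h)
  calc (L : ℝ) ^ n.primeFactors.card = ∏ _p ∈ n.primeFactors, (L : ℝ) := by simp
    _ ≤ ∏ p ∈ n.primeFactors, ((if p < N then (L : ℝ) + 1 else 1) * (p : ℝ) ^ ε) :=
        Finset.prod_le_prod (fun _ _ => by positivity) hterm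
    _ = ((L : ℝ) + 1) ^ (n.primeFactors.filter (· < N)).card * (n : ℝ) ^ ε := by
        rw [Finset.prod_mul_distrib, Real.finsetProd_rpow _ _ (fun _ _ => by positivity),
          ← Nat.cast_prod, Nat.prod_primeFactors_of_squarefree hn, ← Finset.prod_filter,
          Finset.prod_const]
    _ ≤ _ := by
        gcongr
        · simp
        · calc _ ≤ (Finset.range N).card := Finset.card_le_card fun p hp => by
                simpa using (Finset.mem_filter.1 hp).2
            _ = N := Finset.card_range N

theorem stmt_9 (f : MvPolynomial (Fin 2) ℤ) (hsf : Squarefree f)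
    (hnc : 1 ≤ f.totalDegree) :
    ∀ ε : ℝ, 0 < ε → ∃ C : ℝ, 0 < C ∧ ∀ n : ℕ, Squarefree n →
      (Nat.card (Cf f (n ^ 2)) : ℝ) / (Nat.card (GL (Fin 2) (ZMod (n ^ 2))) : ℝ) ≤
        C / (n : ℝ) ^ ((2 : ℝ) - ε) := by
  intro ε hε
  obtain ⟨K, hK⟩ := exists_card_Cf_prime_sq_le hsf
  obtain ⟨C, hC, hCn⟩ := exists_pow_card_primeFactors_le (4 * K) hε
  refine ⟨C, hC, fun n hn => ?_⟩
  have hn0 : n ≠ 0 := hn.ne_zero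
  have hnpos : (0 : ℝ) < n := by positivity
  have : NeZero (n ^ 2) := ⟨by positivity⟩
  set w := n.primeFactors.card with hw
  have hGL : n ^ 8 ≤ 4 ^ w * Nat.card (GL (Fin 2) (ZMod (n ^ 2))) := by
    have htot := le_two_pow_card_primeFactors_mul_totient (n ^ 2)
    rw [Nat.primeFactors_pow n two_ne_zero, ← hw] at htot
    calc n ^ 8 = (n ^ 2) ^ 2 * (n ^ 2) ^ 2 := by ring
      _ ≤ (n ^ 2) ^ 2 * (2 ^ w * (n ^ 2).totient) ^ 2 := by gcongr
      _ = 4 ^ w * ((n ^ 2) ^ 2 * (n ^ 2).totient ^ 2) := by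
          rw [mul_pow, pow_right_comm 2 w 2]; ring
      _ ≤ _ := by gcongr; exact card_GL_two_ge (n ^ 2)
  have hnum : (Nat.card (Cf f (n ^ 2)) : ℝ) ≤ (K : ℝ) ^ w * (n : ℝ) ^ 6 := by
    exact_mod_cast card_Cf_sq_le hK n hn
  have hden : (n : ℝ) ^ 8 ≤ 4 ^ w * (Nat.card (GL (Fin 2) (ZMod (n ^ 2))) : ℝ) := by
    exact_mod_cast hGL
  have hcard : (0 : ℝ) < Nat.card (GL (Fin 2) (ZMod (n ^ 2))) := by
    exact_mod_cast Nat.card_pos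
  have hC' := hCn n hn
  push_cast at hC'
  rw [Real.rpow_sub hnpos, Real.rpow_two, div_div_eq_mul_div, div_le_div_iff₀ hcard (by positivity)]
  have hn6 : (0 : ℝ) < (n : ℝ) ^ 6 := by positivity
  refine le_of_mul_le_mul_left ?_ hn6
  calc (n : ℝ) ^ 6 * (Nat.card (Cf f (n ^ 2)) * (n : ℝ) ^ 2)
      = (n : ℝ) ^ 8 * Nat.card (Cf f (n ^ 2)) := by ring
    _ ≤ (4 ^ w * (Nat.card (GL (Fin 2) (ZMod (n ^ 2))) : ℝ)) * ((K : ℝ) ^ w * (n : ℝ) ^ 6) := by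
        gcongr
    _ = (n : ℝ) ^ 6 * ((4 * (K : ℝ)) ^ w * (Nat.card (GL (Fin 2) (ZMod (n ^ 2))) : ℝ)) := by
        rw [mul_pow]; ring
    _ ≤ _ := by gcongr
end

section
/- Let ℓ be any prime. Then the number of matrices g ∈ GL₂(ℤ/ℓ²ℤ) satisfying det g + 1 = tr g in ℤ/ℓ²ℤ is exactly ℓ³(ℓ³ − ℓ − 1). Equivalently, for f(x,y) = y + 1 − x, |C_f(ℓ²)| / |GL₂(ℤ/ℓ²ℤ)| = (ℓ³ − ℓ − 1) / (ℓ²(ℓ² − 1)(ℓ − 1)). -/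
open Matrix

theorem card_units_eq_card_isUnit (M : Type*) [Monoid M] :
    Nat.card Mˣ = Nat.card {x : M // IsUnit x} :=
  Nat.card_eq_of_bijective (fun u => ⟨u, u.isUnit⟩)
    ⟨fun _ _ h => Units.ext (congrArg Subtype.val h), fun ⟨_, u, hu⟩ => ⟨u, Subtype.ext hu⟩⟩

section Counting

open Finset

theorem card_filter_comp_of_surjective {G H : Type*} [AddGroup G] [AddGroup H] [Fintype G]
    [Fintype H] [DecidableEq H] (f : G →+ H) (hf : Function.Surjective f) {k : ℕ}
    (hk : Fintype.card G = k * Fintype.card H) (P : H → Prop) [DecidablePred P] :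
    #{x : G | P (f x)} = k * #{y : H | P y} := by
  have hfib : ∀ y : H, #{x : G | f x = y} = #{x : G | f x = 0} := fun y =>
    AddMonoidHom.card_fiber_eq_of_mem_range f (hf y) (hf 0)
  have hcount : ∀ (Q : H → Prop) [DecidablePred Q],
      #{x : G | Q (f x)} = #{x : G | f x = 0} * #{y : H | Q y} := by
    intro Q _
    rw [Finset.card_eq_sum_card_fiberwise (f := f) (t := ({y : H | Q y} : Finset H))
      (fun x hx => by simpa using hx), mul_comm, ← smul_eq_mul, ← Finset.sum_const]
    refine Finset.sum_congr rfl fun y hy => ?_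
    rw [← hfib y, Finset.filter_filter]
    congr 1
    ext x
    simp only [mem_filter, mem_univ, true_and] at hy ⊢
    exact ⟨fun h => h.2, fun h => ⟨h ▸ hy, h⟩⟩
  have hall := hcount (fun _ => True)
  simp only [Finset.filter_true, Finset.card_univ, hk] at hall
  rw [hcount P, ← Nat.eq_of_mul_eq_mul_right Fintype.card_pos hall]

variable {R F : Type*} [CommRing R] [Field F] {f : R →+* F}

theorem isUnit_iff_map_ne_zero_of_mul_eq_zero (hf : Function.Surjective f)
    (hsq : ∀ x y, f x = 0 → f y = 0 → x * y = 0) (x : R) : IsUnit x ↔ f x ≠ 0 := by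
  refine ⟨fun h => (h.map f).ne_zero, fun h => ?_⟩
  obtain ⟨y, hy⟩ := hf (f x)⁻¹
  have h0 : f (x * y - 1) = 0 := by simp [hy, h]
  have h1 := hsq _ _ h0 h0
  exact IsUnit.of_mul_eq_one (y * (2 - x * y)) (by linear_combination -h1)

variable [Fintype F] [DecidableEq F]

theorem card_ne_zero_and_one_add_ne_zero :
    (#{x : F | x ≠ 0 ∧ 1 + x ≠ 0} : ℤ) = Fintype.card F - 2 := by
  have h : ({x : F | x ≠ 0 ∧ 1 + x ≠ 0} : Finset F) = univ \ {0, -1} := by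
    ext x
    have : 1 + x = 0 ↔ x = -1 := by grind
    simp [this]
  rw [h, Finset.cast_card_sdiff (Finset.subset_univ _), Finset.card_pair (by simp)]
  simp

theorem card_one_add_ne_zero : (#{x : F | 1 + x ≠ 0} : ℤ) = Fintype.card F - 1 := by
  have h : ({x : F | 1 + x ≠ 0} : Finset F) = univ \ {-1} := by
    ext x
    have : 1 + x = 0 ↔ x = -1 := by grind
    simp [this]
  rw [h, Finset.cast_card_sdiff (Finset.subset_univ _)]
  simp

theorem card_filter_ne_zero : (#{x : F | x ≠ 0} : ℤ) = Fintype.card F - 1 := by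
  have h : ({x : F | x ≠ 0} : Finset F) = univ \ {0} := by
    ext x
    simp
  rw [h, Finset.cast_card_sdiff (Finset.subset_univ _)]
  simp

theorem card_pair_one_add_add_ne_zero :
    (#{p : F × F | 1 + p.1 + p.2 ≠ 0} : ℤ) = Fintype.card F * (Fintype.card F - 1) := by
  rw [← card_filter_ne_zero (F := F), ← Finset.card_univ (α := F), ← Nat.cast_mul, ← Finset.card_product]
  congr 1
  refine Finset.card_nbij' (fun p => (p.1, 1 + p.1 + p.2)) (fun p => (p.1, p.2 - 1 - p.1))
    ?_ ?_ ?_ ?_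
  · intro p; simp
  · intro p; simp
  · intro p _; ext <;> simp; ring
  · intro p _; ext <;> simp

theorem card_pair_mul_eq_zero_and_one_add_add_ne_zero :
    (#{p : F × F | p.1 * p.2 = 0 ∧ 1 + p.1 + p.2 ≠ 0} : ℤ) = 2 * Fintype.card F - 3 := by
  have h : ({p : F × F | p.1 * p.2 = 0 ∧ 1 + p.1 + p.2 ≠ 0} : Finset (F × F)) =
      ({0} ×ˢ ({x : F | 1 + x ≠ 0} : Finset F)) ∪
      (({x : F | x ≠ 0 ∧ 1 + x ≠ 0} : Finset F) ×ˢ {0}) := by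
    ext ⟨x, y⟩
    simp only [mem_filter, mem_univ, true_and, mem_union, mem_product, mem_singleton, mul_eq_zero]
    grind
  rw [h, Finset.card_union_of_disjoint]
  · simp only [Finset.card_product, Finset.card_singleton, one_mul, mul_one]
    push_cast
    rw [card_one_add_ne_zero, card_ne_zero_and_one_add_ne_zero]
    ring
  · rw [Finset.disjoint_left]
    rintro ⟨x, y⟩
    simp only [mem_filter, mem_univ, true_and, mem_product, mem_singleton]
    grind

variable [Fintype R]

theorem card_filter_map (hf : Function.Surjective f)
    (hR : Fintype.card R = Fintype.card F * Fintype.card F) (P : F → Prop) [DecidablePred P] :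
    #{x : R | P (f x)} = Fintype.card F * #{y : F | P y} :=
  card_filter_comp_of_surjective (f : R →+ F) hf hR P

theorem card_filter_map_pair (hf : Function.Surjective f)
    (hR : Fintype.card R = Fintype.card F * Fintype.card F) (P : F × F → Prop) [DecidablePred P] :
    #{p : R × R | P (f p.1, f p.2)} = Fintype.card F ^ 2 * #{y : F × F | P y} := by
  refine card_filter_comp_of_surjective ((f : R →+ F).prodMap (f : R →+ F)) (hf.prodMap hf) ?_ P
  simp only [Fintype.card_prod, hR]
  ring

theorem card_filter_map_eq_zero (hf : Function.Surjective f)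
    (hR : Fintype.card R = Fintype.card F * Fintype.card F) :
    #{x : R | f x = 0} = Fintype.card F := by
  rw [card_filter_map hf hR (fun y => y = 0), Finset.card_eq_one.2 ⟨0, by ext; simp⟩, mul_one]

theorem card_GL_of_square_zero {n : Type*} [Fintype n] [DecidableEq n]
    (hf : Function.Surjective f) (hsq : ∀ x y, f x = 0 → f y = 0 → x * y = 0)
    (hR : Fintype.card R = Fintype.card F * Fintype.card F) :
    Nat.card (GL n R) = Fintype.card F ^ (Fintype.card n * Fintype.card n) * Nat.card (GL n F) := by
  have hu := isUnit_iff_map_ne_zero_of_mul_eq_zero hf hsq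
  have hunit (M : Matrix n n R) : IsUnit M ↔ (f.mapMatrix M).det ≠ 0 := by
    rw [Matrix.isUnit_iff_isUnit_det, hu, RingHom.map_det]
  have hunitF (M : Matrix n n F) : IsUnit M ↔ M.det ≠ 0 := by
    rw [Matrix.isUnit_iff_isUnit_det, isUnit_iff_ne_zero]
  have hsurj : Function.Surjective (f.mapMatrix : Matrix n n R →+* Matrix n n F) := fun M =>
    ⟨M.map (Function.surjInv hf), by ext; simp [Function.surjInv_eq hf]⟩
  rw [Matrix.GeneralLinearGroup, Matrix.GeneralLinearGroup, card_units_eq_card_isUnit,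
    card_units_eq_card_isUnit, Nat.card_congr (Equiv.subtypeEquivRight hunit),
    Nat.card_congr (Equiv.subtypeEquivRight hunitF), Nat.card_eq_fintype_card,
    Nat.card_eq_fintype_card, Fintype.card_subtype, Fintype.card_subtype]
  refine card_filter_comp_of_surjective
    ((f.mapMatrix : Matrix n n R →+* Matrix n n F) : Matrix n n R →+ Matrix n n F) hsurj ?_
    (fun M => M.det ≠ 0)
  rw [Fintype.card_congr Matrix.of.symm, Fintype.card_congr (Matrix.of (α := F)).symm]
  simp [hR, mul_pow, pow_mul]

variable [DecidableEq R]

theorem card_pair_mul_eq_zero_of_square_zero (hf : Function.Surjective f)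
    (hsq : ∀ x y, f x = 0 → f y = 0 → x * y = 0)
    (hR : Fintype.card R = Fintype.card F * Fintype.card F) :
    (#{p : R × R | p.1 * p.2 = 0 ∧ 1 + f p.1 + f p.2 ≠ 0} : ℤ) =
      Fintype.card F * (3 * Fintype.card F - 4) := by
  have hu := isUnit_iff_map_ne_zero_of_mul_eq_zero hf hsq
  have hz := card_filter_map_eq_zero hf hR
  have h : ({p : R × R | p.1 * p.2 = 0 ∧ 1 + f p.1 + f p.2 ≠ 0} : Finset (R × R)) =
      (({x : R | f x = 0} : Finset R) ×ˢ ({x : R | f x = 0} : Finset R)) ∪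
      ((({x : R | f x ≠ 0 ∧ 1 + f x ≠ 0} : Finset R) ×ˢ {0}) ∪
      ({0} ×ˢ ({x : R | f x ≠ 0 ∧ 1 + f x ≠ 0} : Finset R))) := by
    ext ⟨x, y⟩
    simp only [mem_filter, mem_univ, true_and, mem_union, mem_product, mem_singleton]
    by_cases hx : f x = 0
    · by_cases hy : f y = 0
      · simp [hx, hy, hsq x y hx hy]
      · rw [((hu y).2 hy).mul_left_eq_zero]
        simp only [hx, hy]
        grind
    · rw [((hu x).2 hx).mul_right_eq_zero]
      simp only [hx]
      have : y = 0 → f y = 0 := fun h => by simp [h]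
      have : x = 0 → f x = 0 := fun h => by simp [h]
      grind
  have h0 := map_zero f
  rw [h, Finset.card_union_of_disjoint, Finset.card_union_of_disjoint]
  · simp only [Finset.card_product, Finset.card_singleton, one_mul, mul_one, hz]
    rw [card_filter_map hf hR (fun y => y ≠ 0 ∧ 1 + y ≠ 0)]
    push_cast
    rw [card_ne_zero_and_one_add_ne_zero]
    ring
  all_goals
    rw [Finset.disjoint_left]
    rintro ⟨x, y⟩
    simp only [mem_filter, mem_univ, true_and, mem_product, mem_singleton, mem_union]
    grind

/-- The quadruples `((b, c), (x, w))` such that `!![1 + x, b; c, 1 + w]` is invertible and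
satisfies `det + 1 = trace`, counted over a square-zero extension `R` of the field `F`. -/
theorem card_quadruple_mul_eq_mul (hf : Function.Surjective f)
    (hsq : ∀ x y, f x = 0 → f y = 0 → x * y = 0)
    (hR : Fintype.card R = Fintype.card F * Fintype.card F) :
    (#{t : (R × R) × (R × R) | t.2.1 * t.2.2 = t.1.1 * t.1.2 ∧ 1 + f t.2.1 + f t.2.2 ≠ 0} : ℤ) =
      (Fintype.card F : ℤ) ^ 3 * ((Fintype.card F : ℤ) ^ 3 - Fintype.card F - 1) := by
  have hu := isUnit_iff_map_ne_zero_of_mul_eq_zero hf hsq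
  have hinv : ∀ b, f b ≠ 0 → b * Ring.inverse b = 1 := fun b hb =>
    Ring.mul_inverse_cancel b ((hu b).2 hb)
  have hz := card_filter_map_eq_zero hf hR
  have hnz : (#{x : R | f x ≠ 0} : ℤ) = Fintype.card F * (Fintype.card F - 1) := by
    rw [card_filter_map hf hR (fun y => y ≠ 0), Nat.cast_mul, card_filter_ne_zero]
  set S : Finset ((R × R) × (R × R)) :=
    {t | t.2.1 * t.2.2 = t.1.1 * t.1.2 ∧ 1 + f t.2.1 + f t.2.2 ≠ 0} with hS
  have hb : #{t ∈ S | f t.1.1 ≠ 0} =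
      #{x : R | f x ≠ 0} * #{p : R × R | 1 + f p.1 + f p.2 ≠ 0} := by
    rw [← Finset.card_product]
    refine Finset.card_nbij' (fun t => (t.1.1, t.2))
      (fun s => ((s.1, s.2.1 * s.2.2 * Ring.inverse s.1), s.2)) ?_ ?_ ?_ ?_
    · rintro ⟨⟨b, c⟩, x, w⟩ h
      simp [hS] at h ⊢
      tauto
    · rintro ⟨b, x, w⟩ h
      simp [hS] at h ⊢
      refine ⟨⟨?_, h.2⟩, h.1⟩
      linear_combination (-(x * w)) * hinv b h.1
    · rintro ⟨⟨b, c⟩, x, w⟩ h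
      simp [hS] at h ⊢
      linear_combination (Ring.inverse b) * h.1.1 + c * hinv b h.2
    · rintro ⟨b, x, w⟩ h
      simp
  have hc : #{t ∈ {t ∈ S | ¬ f t.1.1 ≠ 0} | f t.1.2 ≠ 0} =
      #{x : R | f x ≠ 0} * #{p : R × R | f p.1 * f p.2 = 0 ∧ 1 + f p.1 + f p.2 ≠ 0} := by
    rw [← Finset.card_product]
    refine Finset.card_nbij' (fun t => (t.1.2, t.2))
      (fun s => ((s.2.1 * s.2.2 * Ring.inverse s.1, s.1), s.2)) ?_ ?_ ?_ ?_
    · rintro ⟨⟨b, c⟩, x, w⟩ h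
      simp only [hS, coe_filter, mem_filter, mem_univ, true_and, Set.mem_ofPred_eq, coe_product,
        Set.mem_prod, not_not] at h ⊢
      refine ⟨h.2, ?_, h.1.1.2⟩
      rw [← map_mul, h.1.1.1, map_mul, h.1.2, zero_mul]
    · rintro ⟨c, x, w⟩ h
      simp only [hS, coe_filter, mem_filter, mem_univ, true_and, Set.mem_ofPred_eq, coe_product,
        Set.mem_prod, not_not] at h ⊢
      refine ⟨⟨⟨?_, h.2.2⟩, ?_⟩, h.1⟩
      · linear_combination (-(x * w)) * hinv c h.1
      · rw [map_mul, map_mul, h.2.1, zero_mul]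
    · rintro ⟨⟨b, c⟩, x, w⟩ h
      simp [hS] at h ⊢
      linear_combination (Ring.inverse c) * h.1.1.1 + b * hinv c h.2
    · rintro ⟨c, x, w⟩ h
      simp
  have hbc : #{t ∈ {t ∈ S | ¬ f t.1.1 ≠ 0} | ¬ f t.1.2 ≠ 0} =
      (#{x : R | f x = 0} * #{x : R | f x = 0}) *
        #{p : R × R | p.1 * p.2 = 0 ∧ 1 + f p.1 + f p.2 ≠ 0} := by
    rw [← Finset.card_product, ← Finset.card_product]
    congr 1
    ext ⟨⟨b, c⟩, x, w⟩
    simp only [hS, mem_filter, mem_univ, true_and, mem_product, not_not]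
    constructor
    · rintro ⟨⟨h, hb⟩, hc⟩
      exact ⟨⟨hb, hc⟩, by rw [h.1, hsq b c hb hc], h.2⟩
    · rintro ⟨⟨hb, hc⟩, h⟩
      exact ⟨⟨⟨by rw [h.1, hsq b c hb hc], h.2⟩, hb⟩, hc⟩
  rw [← Finset.card_filter_add_card_filter_not (s := S) (fun t => f t.1.1 ≠ 0),
    ← Finset.card_filter_add_card_filter_not (s := {t ∈ S | ¬ f t.1.1 ≠ 0})
      (fun t => f t.1.2 ≠ 0), hb, hc, hbc,
    card_filter_map_pair hf hR (fun p => 1 + p.1 + p.2 ≠ 0),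
    card_filter_map_pair hf hR (fun p => p.1 * p.2 = 0 ∧ 1 + p.1 + p.2 ≠ 0)]
  push_cast
  rw [card_pair_one_add_add_ne_zero, card_pair_mul_eq_zero_and_one_add_add_ne_zero,
    card_pair_mul_eq_zero_of_square_zero hf hsq hR, hz, hnz]
  ring

theorem card_GL_two_det_add_one_eq_trace (hf : Function.Surjective f)
    (hsq : ∀ x y, f x = 0 → f y = 0 → x * y = 0)
    (hR : Fintype.card R = Fintype.card F * Fintype.card F) :
    (Nat.card {g : GL (Fin 2) R |
      Matrix.det (g : Matrix (Fin 2) (Fin 2) R) + 1 =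
        Matrix.trace (g : Matrix (Fin 2) (Fin 2) R)} : ℤ) =
      (Fintype.card F : ℤ) ^ 3 * ((Fintype.card F : ℤ) ^ 3 - Fintype.card F - 1) := by
  have hu := isUnit_iff_map_ne_zero_of_mul_eq_zero hf hsq
  rw [← card_quadruple_mul_eq_mul hf hsq hR, ← Fintype.card_subtype, ← Nat.card_eq_fintype_card]
  congr 1
  refine Nat.card_eq_of_bijective
    (fun g => ⟨((g.1.1 0 1, g.1.1 1 0), (g.1.1 0 0 - 1, g.1.1 1 1 - 1)), ?_, ?_⟩) ⟨?_, ?_⟩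
  · have h := g.2
    simp only [Set.mem_ofPred_eq, Matrix.det_fin_two, Matrix.trace_fin_two] at h
    linear_combination h
  · have h := g.2
    have hdet := (hu _).1 ((Matrix.isUnit_iff_isUnit_det _).1 g.1.isUnit)
    simp only [Set.mem_ofPred_eq] at h
    rw [eq_sub_of_add_eq h, Matrix.trace_fin_two] at hdet
    intro h0
    apply hdet
    simp only [map_sub, map_add, map_one] at h0 ⊢
    linear_combination h0
  · intro g g' h
    simp only [Subtype.mk.injEq, Prod.mk.injEq, sub_left_inj] at h
    ext i j
    fin_cases i <;> fin_cases j
    exacts [h.2.1, h.1.1, h.1.2, h.2.2]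
  · rintro ⟨⟨⟨b, c⟩, x, w⟩, h, h1⟩
    have hdet : (!![1 + x, b; c, 1 + w]).det = 1 + x + w := by
      simp only at h
      rw [Matrix.det_fin_two_of]
      linear_combination h
    have hunit : IsUnit (!![1 + x, b; c, 1 + w]) := by
      rw [Matrix.isUnit_iff_isUnit_det, hdet, hu]
      simpa using h1
    obtain ⟨g, hg⟩ := hunit
    refine ⟨⟨g, ?_⟩, ?_⟩
    · simp only [Set.mem_ofPred_eq, hg, hdet, Matrix.trace_fin_two_of]
      ring
    · simp [hg]

end Counting

theorem stmt_15 (ℓ : ℕ) (hℓ : ℓ.Prime) :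
    (Nat.card {g : GL (Fin 2) (ZMod (ℓ ^ 2)) |
        Matrix.det (g : Matrix (Fin 2) (Fin 2) (ZMod (ℓ ^ 2))) + 1 =
          Matrix.trace (g : Matrix (Fin 2) (Fin 2) (ZMod (ℓ ^ 2)))} : ℤ) =
      (ℓ : ℤ) ^ 3 * ((ℓ : ℤ) ^ 3 - (ℓ : ℤ) - 1) ∧
    (Nat.card {g : GL (Fin 2) (ZMod (ℓ ^ 2)) |
        Matrix.det (g : Matrix (Fin 2) (Fin 2) (ZMod (ℓ ^ 2))) + 1 =
          Matrix.trace (g : Matrix (Fin 2) (Fin 2) (ZMod (ℓ ^ 2)))} : ℝ) /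
      (Nat.card (GL (Fin 2) (ZMod (ℓ ^ 2))) : ℝ) =
      ((ℓ : ℝ) ^ 3 - (ℓ : ℝ) - 1) / ((ℓ : ℝ) ^ 2 * ((ℓ : ℝ) ^ 2 - 1) * ((ℓ : ℝ) - 1)) := by
  have : Fact ℓ.Prime := ⟨hℓ⟩
  have hf : Function.Surjective (ZMod.castHom (dvd_pow_self ℓ two_ne_zero) (ZMod ℓ)) :=
    ZMod.castHom_surjective _
  have hsq : ∀ x y : ZMod (ℓ ^ 2), ZMod.castHom (dvd_pow_self ℓ two_ne_zero) (ZMod ℓ) x = 0 →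
      ZMod.castHom (dvd_pow_self ℓ two_ne_zero) (ZMod ℓ) y = 0 → x * y = 0 := by
    intro x y hx hy
    rw [← ZMod.natCast_zmod_val x, map_natCast, ZMod.natCast_eq_zero_iff] at hx
    rw [← ZMod.natCast_zmod_val y, map_natCast, ZMod.natCast_eq_zero_iff] at hy
    rw [← ZMod.natCast_zmod_val x, ← ZMod.natCast_zmod_val y, ← Nat.cast_mul,
      ZMod.natCast_eq_zero_iff]
    exact (sq ℓ).dvd.trans (mul_dvd_mul hx hy)
  have hR : Fintype.card (ZMod (ℓ ^ 2)) = Fintype.card (ZMod ℓ) * Fintype.card (ZMod ℓ) := by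
    simp only [ZMod.card, sq]
  have hcount := card_GL_two_det_add_one_eq_trace hf hsq hR
  have hGL := card_GL_of_square_zero (n := Fin 2) hf hsq hR
  rw [ZMod.card] at hcount
  refine ⟨hcount, ?_⟩
  have hcountR := congrArg (Int.cast : ℤ → ℝ) hcount
  push_cast at hcountR
  have h2 : 2 ≤ ℓ := hℓ.two_le
  have h2R : (2 : ℝ) ≤ ℓ := by exact_mod_cast h2
  have hGLR : (Nat.card (GL (Fin 2) (ZMod (ℓ ^ 2))) : ℝ) =
      (ℓ : ℝ) ^ 5 * ((ℓ : ℝ) ^ 2 - 1) * ((ℓ : ℝ) - 1) := by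
    rw [hGL, Matrix.card_GL_field]
    simp only [Fin.prod_univ_two, ZMod.card, Fintype.card_fin, Nat.cast_mul, Nat.cast_pow]
    rw [Nat.cast_sub (by simp; nlinarith), Nat.cast_sub (by simp; nlinarith)]
    push_cast
    simp
    ring
  rw [hcountR, hGLR]
  have : (ℓ : ℝ) - 1 ≠ 0 := by linarith
  have : (ℓ : ℝ) ^ 2 - 1 ≠ 0 := by nlinarith
  field_simp
end
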